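/- arXiv:1802.01467 — 4 statements merged into one kernel-verified Lean document; each statement's English description precedes it below -/
import Mathlib

section
/- Let l be a natural number and let P : ℝ³ → ℂ be twice continuously differentiable, harmonic (i.e. ∑_{j=1}^{3} ∂²P/∂x_j²(x) = 0 for all x), and satisfying Euler's identity ∑_{j=1}^{3} x_j · ∂P/∂x_j(x) = l · P(x) for all x ∈ ℝ³ (homogeneity of degree l). Then the function Φ : ℝ × ℝ³ → ℂ defined by Φ(t, x) = P(x) / (‖x‖² − (t − i)²)^{l+1} is well defined (the denominator never vanishes) and satisfies the wave equation ∂²Φ/∂t²(t, x) = ∑_{j=1}^{3} ∂²Φ/∂x_j²(t, x) for all (t, x) ∈ ℝ × ℝ³. In particular, every generalized electromagnetic hopfion scalar Φ_H = r^l Y_l/(r² − (t−i)²)^{l+1} and every generalized gravitational hopfion scalar Ψ_H is harmonic with respect to the d'Alembert operator. -/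
/-- Partial derivative in the `j`-th spatial coordinate. -/
noncomputable def pd {F : Type*} [NormedAddCommGroup F] [NormedSpace ℝ F]
    (j : Fin 3) (f : (Fin 3 → ℝ) → F) (x : Fin 3 → ℝ) : F :=
  deriv (fun s => f (Function.update x j s)) (x j)

/-- Partial derivative in the time variable of a time-dependent field. -/
noncomputable def pdt {F : Type*} [NormedAddCommGroup F] [NormedSpace ℝ F]
    (f : ℝ → (Fin 3 → ℝ) → F) (t : ℝ) (x : Fin 3 → ℝ) : F :=
  deriv (fun s => f s x) t

lemma second_deriv_quot (n : ℕ) (p p1 p2 d d1 d2 : ℝ → ℂ)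
    (hp : ∀ s, HasDerivAt p (p1 s) s) (hp1 : ∀ s, HasDerivAt p1 (p2 s) s)
    (hd : ∀ s, HasDerivAt d (d1 s) s) (hd1 : ∀ s, HasDerivAt d1 (d2 s) s)
    (h0 : ∀ s, d s ≠ 0) (s : ℝ) :
    deriv (deriv (fun s => p s / d s ^ (n + 1))) s =
      p2 s / d s ^ (n + 1) - 2 * (n + 1) * p1 s * d1 s / d s ^ (n + 2)
        - (n + 1) * p s * d2 s / d s ^ (n + 2)
        + (n + 1) * (n + 2) * p s * d1 s ^ 2 / d s ^ (n + 3) := by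
  have e1 : deriv (fun s => p s / d s ^ (n + 1)) =
      fun s => p1 s / d s ^ (n + 1) - (n + 1) * (p s * d1 s) / d s ^ (n + 2) := by
    funext s
    have h := (hp s).fun_div ((hd s).fun_pow (n + 1)) (pow_ne_zero _ (h0 s))
    rw [h.deriv]
    have := h0 s
    push_cast
    try simp only [Nat.add_sub_cancel]
    field_simp
    ring
  rw [e1]
  have h := ((hp1 s).fun_div ((hd s).fun_pow (n + 1)) (pow_ne_zero _ (h0 s))).fun_sub
    ((((hp s).fun_mul (hd1 s)).const_mul ((n : ℂ) + 1)).fun_div ((hd s).fun_pow (n + 2))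
      (pow_ne_zero _ (h0 s)))
  rw [h.deriv]
  have := h0 s
  push_cast
  try simp only [Nat.add_sub_cancel, show n + 2 - 1 = n + 1 from rfl]
  field_simp
  ring

lemma pd_pd (j : Fin 3) (f : (Fin 3 → ℝ) → ℂ) (x : Fin 3 → ℝ) :
    pd j (pd j f) x = deriv (deriv (fun s => f (Function.update x j s))) (x j) := by
  simp [pd]

lemma hop_ne (t : ℝ) (x : Fin 3 → ℝ) :
    (((∑ j : Fin 3, (x j) ^ 2 : ℝ) : ℂ) - ((t : ℂ) - Complex.I) ^ 2) ≠ 0 := by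
  intro h
  have hr := congrArg Complex.re h
  have hi := congrArg Complex.im h
  have hs : 0 ≤ ∑ j : Fin 3, (x j) ^ 2 := by positivity
  simp only [Complex.sub_re, Complex.sub_im, Complex.ofReal_re, Complex.ofReal_im, pow_two (_ - _),
    Complex.mul_re, Complex.mul_im, Complex.I_re, Complex.I_im, Complex.zero_re,
    Complex.zero_im] at hr hi
  have : t = 0 := by linarith
  subst this
  linarith

lemma pd_second (l : ℕ) (P : (Fin 3 → ℝ) → ℂ) (hP : ContDiff ℝ 2 P) (t : ℝ) (x : Fin 3 → ℝ)
    (j : Fin 3) (D : ℂ)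
    (hD : D = ((∑ j : Fin 3, (x j) ^ 2 : ℝ) : ℂ) - ((t : ℂ) - Complex.I) ^ 2) :
    pd j (pd j (fun x => P x /
      (((∑ j : Fin 3, (x j) ^ 2 : ℝ) : ℂ) - ((t : ℂ) - Complex.I) ^ 2) ^ (l + 1))) x =
      pd j (pd j P) x / D ^ (l + 1)
        - 2 * (l + 1) * pd j P x * (2 * x j) / D ^ (l + 2)
        - (l + 1) * P x * 2 / D ^ (l + 2)
        + (l + 1) * (l + 2) * P x * (2 * x j) ^ 2 / D ^ (l + 3) := by
  rw [pd_pd, pd_pd]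
  have hg : ContDiff ℝ 2 (fun s => P (Function.update x j s)) :=
    hP.comp (contDiff_update 2 x j)
  have hg1 : ContDiff ℝ 1 (deriv (fun s => P (Function.update x j s))) := by
    have : ContDiff ℝ (1 + 1) (fun s => P (Function.update x j s)) := by
      simpa [one_add_one_eq_two] using hg
    exact (contDiff_succ_iff_deriv.1 this).2.2
  have hsum : ∀ s : ℝ, ∑ k : Fin 3, (Function.update x j s k) ^ 2
      = s ^ 2 + (∑ k : Fin 3, (x k) ^ 2 - x j ^ 2) := by
    intro s
    fin_cases j <;> simp [Fin.sum_univ_three, Function.update] <;> ring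
  rw [second_deriv_quot l (fun s => P (Function.update x j s)) _ _ _
    (fun s => 2 * (s : ℂ)) (fun _ => 2)
    (fun s => (hg.differentiable (by norm_num) s).hasDerivAt)
    (fun s => (hg1.differentiable (by norm_num) s).hasDerivAt) ?_ ?_
    (fun s => hop_ne t (Function.update x j s))]
  · simp only [Function.update_eq_self, ← hD]
    rfl
  · intro s
    simp only [hsum]
    have h := ((((hasDerivAt_id s).ofReal_comp).fun_pow 2).add_const
      (((∑ k : Fin 3, (x k) ^ 2 - x j ^ 2 : ℝ) : ℂ))).sub_const (((t : ℂ) - Complex.I) ^ 2)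
    simpa using h
  · intro s
    simpa using ((hasDerivAt_id s).ofReal_comp).const_mul (2 : ℂ)

lemma pdt_second (l : ℕ) (a c : ℂ) (t : ℝ)
    (h0 : ∀ s : ℝ, c - ((s : ℂ) - Complex.I) ^ 2 ≠ 0) :
    deriv (deriv (fun s : ℝ => a / (c - ((s : ℂ) - Complex.I) ^ 2) ^ (l + 1))) t =
      2 * (l + 1) * a / (c - ((t : ℂ) - Complex.I) ^ 2) ^ (l + 2)
      + (l + 1) * (l + 2) * a * (2 * ((t : ℂ) - Complex.I)) ^ 2
        / (c - ((t : ℂ) - Complex.I) ^ 2) ^ (l + 3) := by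
  have hI : ∀ s : ℝ, HasDerivAt (fun s : ℝ => (s : ℂ) - Complex.I) 1 s := fun s => by
    simpa using ((hasDerivAt_id s).ofReal_comp).sub_const Complex.I
  rw [second_deriv_quot l (fun _ => a) (fun _ => 0) (fun _ => 0) _
    (fun s => -(2 * ((s : ℂ) - Complex.I))) (fun _ => -2)
    (fun s => hasDerivAt_const _ _) (fun s => hasDerivAt_const _ _) ?_ ?_ h0]
  · ring
  · intro s
    simpa using ((hI s).fun_pow 2).const_sub c
  · intro s
    simpa using ((hI s).const_mul 2).fun_neg

/-- If `P : ℝ³ → ℂ` is `C²`, harmonic, and homogeneous of degree `l` (Euler's identity),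
then `Φ(t,x) = P(x)/(‖x‖² − (t−i)²)^{l+1}` is well defined (the denominator never
vanishes) and satisfies the wave equation `∂²Φ/∂t² = ∑_j ∂²Φ/∂x_j²`. -/
theorem generalized_hopfion_wave_equation (l : ℕ) (P : (Fin 3 → ℝ) → ℂ)
    (hP : ContDiff ℝ 2 P)
    (hharm : ∀ x : Fin 3 → ℝ, ∑ j : Fin 3, pd j (pd j P) x = 0)
    (heuler : ∀ x : Fin 3 → ℝ, ∑ j : Fin 3, (x j : ℂ) * pd j P x = (l : ℂ) * P x)
    (Φ : ℝ → (Fin 3 → ℝ) → ℂ)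
    (hΦ : ∀ (t : ℝ) (x : Fin 3 → ℝ), Φ t x =
      P x / (((∑ j : Fin 3, (x j) ^ 2 : ℝ) : ℂ) - ((t : ℂ) - Complex.I) ^ 2) ^ (l + 1)) :
    (∀ (t : ℝ) (x : Fin 3 → ℝ),
      (((∑ j : Fin 3, (x j) ^ 2 : ℝ) : ℂ) - ((t : ℂ) - Complex.I) ^ 2) ≠ 0) ∧
    (∀ (t : ℝ) (x : Fin 3 → ℝ),
      pdt (pdt Φ) t x = ∑ j : Fin 3, pd j (pd j (Φ t)) x) := by
  refine ⟨hop_ne, fun t x => ?_⟩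
  obtain rfl : Φ = fun (t : ℝ) (x : Fin 3 → ℝ) => P x /
      (((∑ j : Fin 3, (x j) ^ 2 : ℝ) : ℂ) - ((t : ℂ) - Complex.I) ^ 2) ^ (l + 1) := by
    funext t x; exact hΦ t x
  have hL := pdt_second l (P x) ((∑ j : Fin 3, (x j) ^ 2 : ℝ) : ℂ) t (fun s => hop_ne s x)
  have hne := hop_ne t x
  have hh := hharm x
  have he := heuler x
  refine Eq.trans hL ?_
  have hR := fun j => pd_second l P hP t x j _ rfl
  simp only [hR]
  obtain ⟨D, hD⟩ : ∃ D, D = ((∑ j : Fin 3, (x j) ^ 2 : ℝ) : ℂ) - ((t : ℂ) - Complex.I) ^ 2 :=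
    ⟨_, rfl⟩
  simp only [← hD] at hne ⊢
  have hτ : ((t : ℂ) - Complex.I) ^ 2 = (x 0 : ℂ) ^ 2 + (x 1 : ℂ) ^ 2 + (x 2 : ℂ) ^ 2 - D := by
    rw [hD]; simp [Fin.sum_univ_three]
  rw [mul_pow, hτ]
  simp only [Fin.sum_univ_three] at hh he ⊢
  field_simp
  linear_combination D ^ (l * 2) * ((-D ^ 5) * hh + 4 * (l + 1) * D ^ 4 * he)
end

section
/- The quadrupole hopfion scalar Φ_q : ℝ × ℝ³ → ℂ defined in Cartesian coordinates by Φ_q(t, x, y, z) = (x + i z)² / (x² + y² + z² − (t − i)²)³ is well defined (the denominator never vanishes) and satisfies the wave equation ∂²Φ_q/∂t² = ∂²Φ_q/∂x² + ∂²Φ_q/∂y² + ∂²Φ_q/∂z² everywhere on ℝ × ℝ³. -/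
/-- The quadrupole hopfion scalar `Φ_q(t,x,y,z) = (x+iz)²/(x²+y²+z²−(t−i)²)³`. -/
noncomputable def Phiq (t x y z : ℝ) : ℂ :=
  ((x : ℂ) + Complex.I * (z : ℂ)) ^ 2 /
    (((x ^ 2 + y ^ 2 + z ^ 2 : ℝ) : ℂ) - ((t : ℂ) - Complex.I) ^ 2) ^ 3

theorem hopf_aux (N D D1 : ℝ → ℂ) (n d : ℂ) (hN : ∀ s, HasDerivAt N n s)
    (hD : ∀ s, HasDerivAt D (D1 s) s) (hD1 : ∀ s, HasDerivAt D1 d s) (h0 : ∀ s, D s ≠ 0) (t : ℝ) :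
    deriv (deriv (fun s => N s ^ 2 / D s ^ 3)) t =
      (2 * n ^ 2 * D t ^ 2 - 12 * n * N t * D1 t * D t - 3 * N t ^ 2 * d * D t
        + 12 * N t ^ 2 * D1 t ^ 2) / D t ^ 5 := by
  have h1 : deriv (fun s => N s ^ 2 / D s ^ 3) =
      fun s => (2 * n * N s * D s - 3 * N s ^ 2 * D1 s) / D s ^ 4 := by
    funext s
    have h := ((hN s).pow 2).div ((hD s).pow 3) (pow_ne_zero 3 (h0 s))
    refine (HasDerivAt.deriv h).trans ?_
    have := h0 s
    simp only [Pi.pow_apply]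
    field_simp
    push_cast
    ring
  rw [h1]
  have h := ((((hN t).const_mul (2 * n)).mul (hD t)).sub
    ((((hN t).pow 2).const_mul 3).mul (hD1 t))).div ((hD t).pow 4) (pow_ne_zero 4 (h0 t))
  refine (HasDerivAt.deriv h).trans ?_
  have := h0 t
  simp only [Pi.pow_apply, Pi.mul_apply, Pi.sub_apply]
  field_simp
  push_cast
  ring

theorem hopf_ne (t x y z : ℝ) :
    (((x ^ 2 + y ^ 2 + z ^ 2 : ℝ) : ℂ) - ((t : ℂ) - Complex.I) ^ 2) ≠ 0 := by
  intro h
  have hr := congrArg Complex.re h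
  have hi := congrArg Complex.im h
  rw [Complex.sub_re, Complex.ofReal_re] at hr
  rw [Complex.sub_im, Complex.ofReal_im] at hi
  simp [pow_two] at hr hi
  have ht : t = 0 := by linarith
  subst ht
  nlinarith [sq_nonneg x, sq_nonneg y, sq_nonneg z]

theorem hopf_id (s : ℝ) : HasDerivAt (fun u : ℝ => (u : ℂ)) 1 s :=
  Complex.ofRealCLM.hasDerivAt

theorem hopf_sq (a c : ℂ) (e : ℂ) (s : ℝ) :
    HasDerivAt (fun u : ℝ => c + e * ((u : ℂ) - a) ^ 2) (2 * e * ((s : ℂ) - a)) s := by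
  refine HasDerivAt.congr_deriv ((((hopf_id s).sub_const a).pow 2).const_mul e |>.const_add c) ?_
  push_cast
  ring

theorem hopf_lin (a e : ℂ) (s : ℝ) :
    HasDerivAt (fun u : ℝ => 2 * e * ((u : ℂ) - a)) (2 * e) s := by
  refine HasDerivAt.congr_deriv (((hopf_id s).sub_const a).const_mul (2 * e)) ?_
  ring

/-- The quadrupole hopfion scalar is well defined (its denominator never vanishes)
and satisfies the wave equation `∂²Φ_q/∂t² = ∂²Φ_q/∂x² + ∂²Φ_q/∂y² + ∂²Φ_q/∂z²`. -/
theorem quadrupole_hopfion_wave_equation :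
    (∀ t x y z : ℝ,
      (((x ^ 2 + y ^ 2 + z ^ 2 : ℝ) : ℂ) - ((t : ℂ) - Complex.I) ^ 2) ≠ 0) ∧
    (∀ t x y z : ℝ,
      deriv (deriv (fun s => Phiq s x y z)) t =
        deriv (deriv (fun s => Phiq t s y z)) x +
        deriv (deriv (fun s => Phiq t x s z)) y +
        deriv (deriv (fun s => Phiq t x y s)) z) := by
  refine ⟨hopf_ne, fun t x y z => ?_⟩
  have hI : Complex.I ^ 2 = -1 := Complex.I_sq
  have e1 := hopf_aux (fun _ => (x : ℂ) + Complex.I * (z : ℂ))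
    (fun s => (((x ^ 2 + y ^ 2 + z ^ 2 : ℝ) : ℂ) - ((s : ℂ) - Complex.I) ^ 2))
    (fun s => 2 * (-1) * ((s : ℂ) - Complex.I)) 0 (2 * (-1)) (fun s => hasDerivAt_const s _)
    (fun s => by
      convert hopf_sq Complex.I ((x ^ 2 + y ^ 2 + z ^ 2 : ℝ) : ℂ) (-1) s using 1
      funext u; ring)
    (fun s => hopf_lin _ _ s) (fun s => hopf_ne s x y z) t
  have e2 := hopf_aux (fun s => (s : ℂ) + Complex.I * (z : ℂ))
    (fun s => (((s ^ 2 + y ^ 2 + z ^ 2 : ℝ) : ℂ) - ((t : ℂ) - Complex.I) ^ 2))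
    (fun s => 2 * 1 * ((s : ℂ) - 0)) 1 (2 * 1) (fun s => (hopf_id s).add_const _)
    (fun s => by
      convert hopf_sq 0 (((y ^ 2 + z ^ 2 : ℝ) : ℂ) - ((t : ℂ) - Complex.I) ^ 2) 1 s using 1
      funext u; push_cast; ring)
    (fun s => hopf_lin _ _ s) (fun s => hopf_ne t s y z) x
  have e3 := hopf_aux (fun _ => (x : ℂ) + Complex.I * (z : ℂ))
    (fun s => (((x ^ 2 + s ^ 2 + z ^ 2 : ℝ) : ℂ) - ((t : ℂ) - Complex.I) ^ 2))
    (fun s => 2 * 1 * ((s : ℂ) - 0)) 0 (2 * 1) (fun s => hasDerivAt_const s _)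
    (fun s => by
      convert hopf_sq 0 (((x ^ 2 + z ^ 2 : ℝ) : ℂ) - ((t : ℂ) - Complex.I) ^ 2) 1 s using 1
      funext u; push_cast; ring)
    (fun s => hopf_lin _ _ s) (fun s => hopf_ne t x s z) y
  have e4 := hopf_aux (fun s => (x : ℂ) + Complex.I * (s : ℂ))
    (fun s => (((x ^ 2 + y ^ 2 + s ^ 2 : ℝ) : ℂ) - ((t : ℂ) - Complex.I) ^ 2))
    (fun s => 2 * 1 * ((s : ℂ) - 0)) Complex.I (2 * 1)
    (fun s => by
      refine HasDerivAt.congr_deriv (((hopf_id s).const_mul Complex.I).const_add (x : ℂ)) ?_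
      ring)
    (fun s => by
      convert hopf_sq 0 (((x ^ 2 + y ^ 2 : ℝ) : ℂ) - ((t : ℂ) - Complex.I) ^ 2) 1 s using 1
      funext u; push_cast; ring)
    (fun s => hopf_lin _ _ s) (fun s => hopf_ne t x y s) z
  simp only [Phiq]
  rw [e1, e2, e3, e4, ← add_div, ← add_div]
  congr 1
  push_cast
  generalize hw : (t : ℂ) - Complex.I = w
  generalize hD : (x : ℂ) ^ 2 + (y : ℂ) ^ 2 + (z : ℂ) ^ 2 - w ^ 2 = D
  generalize hN : (x : ℂ) + Complex.I * (z : ℂ) = N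
  have hw2 : w ^ 2 = (x : ℂ) ^ 2 + (y : ℂ) ^ 2 + (z : ℂ) ^ 2 - D := by rw [← hD]; ring
  linear_combination (48 * N ^ 2) * hw2 - 2 * D ^ 2 * hI + 24 * N * D * hN
end

section
/- Let P : ℝ³ → ℝ^{3×3} be a twice continuously differentiable field of symmetric matrices (P_{ab} = P_{ba}) that is divergence-free: ∑_d ∂_d P_{ad}(x) = 0 for every a and every x ∈ ℝ³. Define B_{ab} = (1/2) ∑_{c,d} ε_{cda} ∂_c P_{bd} + (1/2) ∑_{c,d} ε_{cdb} ∂_c P_{ad} (the symmetric curl of P). Then B is trace-free, ∑_a B_{aa}(x) = 0, and divergence-free, ∑_b ∂_b B_{ab}(x) = 0, for every x ∈ ℝ³. -/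
/-- The Levi-Civita symbol on three indices. -/
noncomputable def eps (a b c : Fin 3) : ℝ :=
  (((b : ℕ) : ℝ) - ((a : ℕ) : ℝ)) * (((c : ℕ) : ℝ) - ((b : ℕ) : ℝ)) *
    (((c : ℕ) : ℝ) - ((a : ℕ) : ℝ)) / 2

theorem pd_eq_fderiv (j : Fin 3) (f : (Fin 3 → ℝ) → ℝ) (hf : Differentiable ℝ f)
    (x : Fin 3 → ℝ) : pd j f x = fderiv ℝ f x (Pi.single j 1) := by
  unfold pd
  have h1 := hasDerivAt_update x j (x j)
  have h2 : HasFDerivAt f (fderiv ℝ f x) (Function.update x j (x j)) := by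
    rw [Function.update_eq_self]; exact (hf x).hasFDerivAt
  exact (h2.comp_hasDerivAt (x j) h1).deriv

theorem pd_comm (f : (Fin 3 → ℝ) → ℝ) (hf : ContDiff ℝ 2 f) (b c : Fin 3)
    (x : Fin 3 → ℝ) :
    fderiv ℝ (fun y => pd c f y) x (Pi.single b 1) =
      fderiv ℝ (fun y => pd b f y) x (Pi.single c 1) := by
  have hd : Differentiable ℝ f := hf.differentiable (by norm_num)
  have hd2 : Differentiable ℝ (fderiv ℝ f) :=
    (hf.fderiv_right (m := 1) (by norm_num)).differentiable (by norm_num)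
  have e : ∀ c b : Fin 3, fderiv ℝ (fun y => pd c f y) x (Pi.single b 1) =
      fderiv ℝ (fderiv ℝ f) x (Pi.single b 1) (Pi.single c 1) := by
    intro c b
    have : (fun y => pd c f y) = fun y => fderiv ℝ f y (Pi.single c 1) := by
      funext y; exact pd_eq_fderiv c f hd y
    rw [this, fderiv_clm_apply (hd2 x) (by fun_prop)]
    simp
  rw [e, e]
  exact (hf.contDiffAt.isSymmSndFDerivAt (by simp)) _ _

theorem pd_differentiable (f : (Fin 3 → ℝ) → ℝ) (hf : ContDiff ℝ 2 f) (c : Fin 3) :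
    Differentiable ℝ (fun y => pd c f y) := by
  have hd : Differentiable ℝ f := hf.differentiable (by norm_num)
  have hd2 : Differentiable ℝ (fderiv ℝ f) :=
    (hf.fderiv_right (m := 1) (by norm_num)).differentiable (by norm_num)
  have : (fun y => pd c f y) = fun y => fderiv ℝ f y (Pi.single c 1) := by
    funext y; exact pd_eq_fderiv c f hd y
  rw [this]
  fun_prop

/-- If `P` is a `C²` symmetric, divergence-free matrix field on `ℝ³`, then its symmetric
curl `B_{ab} = (1/2) ∑_{c,d} ε_{cda} ∂_c P_{bd} + (1/2) ∑_{c,d} ε_{cdb} ∂_c P_{ad}` is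
trace-free and divergence-free. -/
theorem symmetric_curl_trace_free_div_free
    (P : (Fin 3 → ℝ) → Fin 3 → Fin 3 → ℝ)
    (hP : ContDiff ℝ 2 P)
    (hsymm : ∀ (x : Fin 3 → ℝ) (a b : Fin 3), P x a b = P x b a)
    (hdiv : ∀ (x : Fin 3 → ℝ) (a : Fin 3), ∑ d : Fin 3, pd d (fun y => P y a d) x = 0)
    (B : (Fin 3 → ℝ) → Fin 3 → Fin 3 → ℝ)
    (hB : ∀ (x : Fin 3 → ℝ) (a b : Fin 3),
      B x a b = (1 / 2) * (∑ c : Fin 3, ∑ d : Fin 3, eps c d a * pd c (fun y => P y b d) x)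
        + (1 / 2) * (∑ c : Fin 3, ∑ d : Fin 3, eps c d b * pd c (fun y => P y a d) x)) :
    (∀ x : Fin 3 → ℝ, ∑ a : Fin 3, B x a a = 0) ∧
    (∀ (x : Fin 3 → ℝ) (a : Fin 3), ∑ b : Fin 3, pd b (fun y => B y a b) x = 0) := by
  have hc : ∀ a d, ContDiff ℝ 2 (fun y => P y a d) := by
    intro a d
    exact contDiff_pi.1 (contDiff_pi.1 hP a) d
  have hs : ∀ a d, (fun y => P y a d) = (fun y => P y d a) := fun a d => by
    funext y; exact hsymm y a d
  have hD : ∀ c a d, Differentiable ℝ (fun y => pd c (fun y => P y a d) y) :=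
    fun c a d => pd_differentiable _ (hc a d) c
  refine ⟨?_, ?_⟩
  · intro x
    simp only [hB, Fin.sum_univ_three]
    rw [hs 1 0, hs 2 0, hs 2 1]
    simp [eps]
    ring
  · intro x a
    have hBd : ∀ b, pd b (fun y => B y a b) x =
        (1 / 2) * (∑ c : Fin 3, ∑ d : Fin 3, eps c d a *
            fderiv ℝ (fun y => pd c (fun y => P y b d) y) x (Pi.single b 1))
        + (1 / 2) * (∑ c : Fin 3, ∑ d : Fin 3, eps c d b *
            fderiv ℝ (fun y => pd c (fun y => P y a d) y) x (Pi.single b 1)) := by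
      intro b
      have hfd : HasFDerivAt (fun y => B y a b)
          ((1 / 2 : ℝ) • (∑ c : Fin 3, ∑ d : Fin 3, eps c d a •
            fderiv ℝ (fun y => pd c (fun y => P y b d) y) x)
          + (1 / 2 : ℝ) • (∑ c : Fin 3, ∑ d : Fin 3, eps c d b •
            fderiv ℝ (fun y => pd c (fun y => P y a d) y) x)) x := by
        simp only [hB]
        refine HasFDerivAt.add (HasFDerivAt.const_mul ?_ _) (HasFDerivAt.const_mul ?_ _)
        all_goals
          refine HasFDerivAt.fun_sum fun c _ => HasFDerivAt.fun_sum fun d _ => ?_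
          exact HasFDerivAt.const_mul (hD _ _ _ x).hasFDerivAt _
      have hdB : Differentiable ℝ (fun y => B y a b) := by
        simp only [hB]
        fun_prop
      rw [pd_eq_fderiv _ _ hdB, hfd.fderiv]
      simp
    have hdd : ∀ a b, ∑ d : Fin 3,
        fderiv ℝ (fun y => pd d (fun y => P y a d) y) x (Pi.single b 1) = 0 := by
      intro a b
      have h1 : HasFDerivAt (fun y => ∑ d : Fin 3, pd d (fun y => P y a d) y)
          (∑ d : Fin 3, fderiv ℝ (fun y => pd d (fun y => P y a d) y) x) x :=
        HasFDerivAt.fun_sum fun d _ => (hD _ _ _ x).hasFDerivAt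
      simp only [hdiv] at h1
      have h2 := h1.unique (hasFDerivAt_const (0 : ℝ) x)
      simpa using congrArg (fun L => L (Pi.single b 1)) h2
    simp only [hBd]
    have hcm : ∀ a d b c, fderiv ℝ (fun y => pd c (fun y => P y a d) y) x (Pi.single b 1) =
      fderiv ℝ (fun y => pd b (fun y => P y a d) y) x (Pi.single c 1) :=
      fun a d b c => pd_comm _ (hc a d) b c x
    have hsm : ∀ a d b c, fderiv ℝ (fun y => pd c (fun y => P y a d) y) x (Pi.single b 1) =
      fderiv ℝ (fun y => pd c (fun y => P y d a) y) x (Pi.single b 1) :=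
      fun a d b c => by rw [hs a d]
    generalize hQ : (fun a d b c => fderiv ℝ (fun y => pd c (fun y => P y a d) y) x
      (Pi.single b 1)) = Q at *
    have hQ' : ∀ a d b c, fderiv ℝ (fun y => pd c (fun y => P y a d) y) x (Pi.single b 1)
      = Q a d b c := fun a d b c => by rw [← hQ]
    simp only [hQ'] at hdd hcm hsm ⊢
    clear hBd hQ hQ'
    simp only [Fin.sum_univ_three] at hdd ⊢
    have c01 := fun a d => hcm a d 1 0
    have c02 := fun a d => hcm a d 2 0
    have c12 := fun a d => hcm a d 2 1
    have s01 := hsm 1 0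
    have s02 := hsm 2 0
    have s12 := hsm 2 1
    simp only [s01, s02, s12, c01, c02, c12] at hdd ⊢
    have d00 := hdd 0 0
    have d01 := hdd 0 1
    have d02 := hdd 0 2
    have d10 := hdd 1 0
    have d11 := hdd 1 1
    have d12 := hdd 1 2
    have d20 := hdd 2 0
    have d21 := hdd 2 1
    have d22 := hdd 2 2
    simp only [s01, s02, s12, c01, c02, c12] at d00 d01 d02 d10 d11 d12 d20 d21 d22
    fin_cases a <;> simp [eps, s01, s02, s12, c01, c02, c12] <;> linarith
end

section
/- Let ψ : ℝ × ℝ → ℂ be the time–radius part of the quadrupole hopfion, ψ(t, r) = r² / (r² − (t − i)²)³, and define ξ(t, r) = r⁴ · (t⁴ + ((14/5) r² + 2) t² + (r² + 1)²) / (((r + t)² + 1)⁴ · ((r − t)² + 1)⁴). Then for all real t and r: (1/6) · ( r² · |∂ψ/∂t (t, r)|² + |∂/∂r ( r · ψ(t, r) )|² ) + |ψ(t, r)|² = (5/2) · ξ(t, r). -/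
/-- Time–radius part of the quadrupole hopfion: `ψ(t,r) = r²/(r² − (t−i)²)³`. -/
noncomputable def psiq (t r : ℝ) : ℂ :=
  (r : ℂ) ^ 2 / ((r : ℂ) ^ 2 - ((t : ℂ) - Complex.I) ^ 2) ^ 3

/-- The profile `ξ(t,r)` of the quasi-local electromagnetic energy density of the
quadrupole hopfion. -/
noncomputable def xiq (t r : ℝ) : ℝ :=
  r ^ 4 * (t ^ 4 + ((14 / 5) * r ^ 2 + 2) * t ^ 2 + (r ^ 2 + 1) ^ 2) /
    (((r + t) ^ 2 + 1) ^ 4 * ((r - t) ^ 2 + 1) ^ 4)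

theorem aux_normSq_D (t r : ℝ) :
    Complex.normSq ((r : ℂ) ^ 2 - ((t : ℂ) - Complex.I) ^ 2)
      = ((r + t) ^ 2 + 1) * ((r - t) ^ 2 + 1) := by
  simp [Complex.normSq_apply, pow_two]
  ring

theorem aux_D_ne (t r : ℝ) : ((r : ℂ) ^ 2 - ((t : ℂ) - Complex.I) ^ 2) ≠ 0 := by
  rw [← Complex.normSq_pos, aux_normSq_D]
  positivity

theorem aux_deriv_t (t r : ℝ) : deriv (fun s => psiq s r) t =
    6 * ((t : ℂ) - Complex.I) * (r : ℂ) ^ 2 / ((r : ℂ) ^ 2 - ((t : ℂ) - Complex.I) ^ 2) ^ 4 := by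
  have hD := aux_D_ne t r
  have h0 : HasDerivAt (fun s : ℝ => (s : ℂ)) 1 t := Complex.ofRealCLM.hasDerivAt
  have h1 := (((h0.sub_const Complex.I).fun_pow 2).const_sub ((r : ℂ) ^ 2)).fun_pow 3
  have h2 := (hasDerivAt_const t ((r : ℂ) ^ 2)).fun_div h1 (pow_ne_zero 3 hD)
  unfold psiq
  rw [h2.deriv]
  field_simp
  push_cast
  ring

theorem aux_deriv_r (t r : ℝ) : deriv (fun s : ℝ => (s : ℂ) * psiq t s) r =
    -3 * (r : ℂ) ^ 2 * ((r : ℂ) ^ 2 + ((t : ℂ) - Complex.I) ^ 2)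
      / ((r : ℂ) ^ 2 - ((t : ℂ) - Complex.I) ^ 2) ^ 4 := by
  have hD := aux_D_ne t r
  have h0 : HasDerivAt (fun s : ℝ => (s : ℂ)) 1 r := Complex.ofRealCLM.hasDerivAt
  have h1 := ((h0.fun_pow 2).sub_const (((t : ℂ) - Complex.I) ^ 2)).fun_pow 3
  have h2 := h0.fun_mul ((h0.fun_pow 2).fun_div h1 (pow_ne_zero 3 hD))
  unfold psiq
  rw [h2.deriv]
  field_simp
  push_cast
  ring

/-- Time–radius reduction of the quasi-local electromagnetic energy density of the
quadrupole hopfion: `(1/6)(r²|∂ψ/∂t|² + |∂_r(rψ)|²) + |ψ|² = (5/2)ξ(t,r)`. -/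
theorem quadrupole_energy_density_identity (t r : ℝ) :
    (1 / 6) * (r ^ 2 * ‖deriv (fun s => psiq s r) t‖ ^ 2
        + ‖deriv (fun s : ℝ => (s : ℂ) * psiq t s) r‖ ^ 2)
      + ‖psiq t r‖ ^ 2 = (5 / 2) * xiq t r := by
  have hw : Complex.normSq ((t : ℂ) - Complex.I) = t ^ 2 + 1 := by
    simp [Complex.normSq_apply, pow_two]
  have hp : Complex.normSq ((r : ℂ) ^ 2 + ((t : ℂ) - Complex.I) ^ 2)
      = (r ^ 2 + t ^ 2 - 1) ^ 2 + 4 * t ^ 2 := by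
    simp [Complex.normSq_apply, pow_two]
    ring
  have h6 : Complex.normSq 6 = 36 := by
    rw [Complex.normSq_ofNat]; norm_num
  have h3 : Complex.normSq (-3) = 9 := by
    rw [Complex.normSq_neg, Complex.normSq_ofNat]; norm_num
  rw [aux_deriv_t, aux_deriv_r]
  unfold psiq xiq
  simp only [← Complex.normSq_eq_norm_sq, map_div₀, map_mul, map_pow, aux_normSq_D, hw, hp, h6, h3,
    Complex.normSq_ofReal]
  have hA : (r + t) ^ 2 + 1 ≠ 0 := by positivity
  have hB : (r - t) ^ 2 + 1 ≠ 0 := by positivity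
  field_simp
  ring
end
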